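/- arXiv:1402.0032 — 2 statements merged into one kernel-verified Lean document; each statement's English description precedes it below -/
import Mathlib

section
/- Let X be a three-dimensional real Banach space and V a two-dimensional subspace of X. Assume λ_w^{id_V} = inf{‖P‖_w : P ∈ 𝒫(X,V)} > 1. Then there exists exactly one projection P_o ∈ 𝒫(X,V) of minimal numerical radius, i.e. with ‖P_o‖_w = λ_w^{id_V}, and P_o is strongly unique: there exists r > 0 such that ‖P‖_w ≥ ‖P_o‖_w + r·‖P − P_o‖_w for every P ∈ 𝒫(X,V). -/
/-- The numerical radius of a bounded linear operator `S` on a normed space `X`: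
`‖S‖_w = sup {|x*(Sx)| : ‖x‖ = ‖x*‖ = 1, x*(x) = 1}`. -/
noncomputable def numericalRadius (X : Type*) [NormedAddCommGroup X]
    [NormedSpace ℝ X] (S : X →L[ℝ] X) : ℝ :=
  sSup {r : ℝ | ∃ (x : X) (f : X →L[ℝ] ℝ), ‖x‖ = 1 ∧ ‖f‖ = 1 ∧ f x = 1 ∧ r = ‖f (S x)‖}

open Filter Topology

/-- The pairs `(x, f)` of norm-one vectors and norm-one functionals with `f x = 1`. -/
def statePairs (X : Type*) [NormedAddCommGroup X] [NormedSpace ℝ X] :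
    Set (X × (X →L[ℝ] ℝ)) :=
  {p | ‖p.1‖ = 1 ∧ ‖p.2‖ = 1 ∧ p.2 p.1 = 1}

lemma numericalRadius_eq_sSup_image {X : Type*} [NormedAddCommGroup X] [NormedSpace ℝ X]
    (S : X →L[ℝ] X) :
    numericalRadius X S = sSup ((fun p => ‖p.2 (S p.1)‖) '' statePairs X) := by
  unfold numericalRadius statePairs
  congr 1
  ext r
  constructor
  · rintro ⟨x, f, hx, hf, hfx, rfl⟩
    exact ⟨(x, f), ⟨hx, hf, hfx⟩, rfl⟩
  · rintro ⟨⟨x, f⟩, ⟨hx, hf, hfx⟩, rfl⟩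
    exact ⟨x, f, hx, hf, hfx, rfl⟩

lemma continuous_apply_statePair {X : Type*} [NormedAddCommGroup X] [NormedSpace ℝ X]
    (S : X →L[ℝ] X) : Continuous fun p : X × (X →L[ℝ] ℝ) => p.2 (S p.1) := by
  fun_prop

lemma norm_apply_le_of_mem_statePairs {X : Type*} [NormedAddCommGroup X] [NormedSpace ℝ X]
    {p : X × (X →L[ℝ] ℝ)} (hp : p ∈ statePairs X) (v : X) : ‖p.2 v‖ ≤ ‖v‖ := by
  simpa [hp.2.1] using p.2.le_opNorm v

lemma isCompact_statePairs (X : Type*) [NormedAddCommGroup X] [NormedSpace ℝ X]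
    [FiniteDimensional ℝ X] : IsCompact (statePairs X) := by
  have : ProperSpace X := FiniteDimensional.proper ℝ X
  have : ProperSpace (X →L[ℝ] ℝ) := FiniteDimensional.proper ℝ _
  refine ((isCompact_closedBall (0 : X) 1).prod
    (isCompact_closedBall (0 : X →L[ℝ] ℝ) 1)).of_isClosed_subset ?_ ?_
  · refine (isClosed_eq (by fun_prop) continuous_const).inter
      ((isClosed_eq (by fun_prop) continuous_const).inter
        (isClosed_eq (f := fun p : X × (X →L[ℝ] ℝ) => p.2 p.1) (by fun_prop) continuous_const))
  · rintro ⟨x, f⟩ ⟨hx, hf, -⟩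
    simp_all

lemma exists_mem_statePairs {X : Type*} [NormedAddCommGroup X] [NormedSpace ℝ X]
    {z : X} (hz : z ≠ 0) : ∃ p ∈ statePairs X, p.1 = ‖z‖⁻¹ • z ∧ p.2 z = ‖z‖ := by
  obtain ⟨f, hf, hfz⟩ := exists_dual_vector ℝ z (norm_ne_zero_iff.2 hz)
  have h0 : ‖z‖ ≠ 0 := norm_ne_zero_iff.2 hz
  refine ⟨(‖z‖⁻¹ • z, f), ⟨?_, hf, ?_⟩, rfl, by simpa using hfz⟩
  · simp [norm_smul, h0]
  · simp at hfz
    simp [hfz, h0]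

lemma le_numericalRadius {X : Type*} [NormedAddCommGroup X] [NormedSpace ℝ X]
    [FiniteDimensional ℝ X] (S : X →L[ℝ] X) {p : X × (X →L[ℝ] ℝ)} (hp : p ∈ statePairs X) :
    ‖p.2 (S p.1)‖ ≤ numericalRadius X S := by
  rw [numericalRadius_eq_sSup_image]
  exact le_csSup ((isCompact_statePairs X).image
    (continuous_apply_statePair S).norm).bddAbove ⟨p, hp, rfl⟩

lemma exists_eq_numericalRadius {X : Type*} [NormedAddCommGroup X] [NormedSpace ℝ X]
    [FiniteDimensional ℝ X] [Nontrivial X] (S : X →L[ℝ] X) :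
    ∃ p ∈ statePairs X, ‖p.2 (S p.1)‖ = numericalRadius X S := by
  rw [numericalRadius_eq_sSup_image]
  obtain ⟨z, hz⟩ := exists_ne (0 : X)
  obtain ⟨p, hp, -⟩ := exists_mem_statePairs hz
  exact ((isCompact_statePairs X).image (continuous_apply_statePair S).norm).sSup_mem
    ⟨_, p, hp, rfl⟩

lemma numericalRadius_nonneg {X : Type*} [NormedAddCommGroup X] [NormedSpace ℝ X]
    (S : X →L[ℝ] X) : 0 ≤ numericalRadius X S := by
  rw [numericalRadius_eq_sSup_image]
  refine Real.sSup_nonneg ?_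
  rintro _ ⟨p, -, rfl⟩
  exact norm_nonneg _

lemma numericalRadius_add_le {X : Type*} [NormedAddCommGroup X] [NormedSpace ℝ X]
    [FiniteDimensional ℝ X] [Nontrivial X] (S T : X →L[ℝ] X) :
    numericalRadius X (S + T) ≤ numericalRadius X S + numericalRadius X T := by
  obtain ⟨p, hp, h⟩ := exists_eq_numericalRadius (S + T)
  rw [← h, add_apply, map_add]
  exact (norm_add_le _ _).trans (add_le_add (le_numericalRadius S hp) (le_numericalRadius T hp))

lemma numericalRadius_le_norm {X : Type*} [NormedAddCommGroup X] [NormedSpace ℝ X]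
    [FiniteDimensional ℝ X] [Nontrivial X] (S : X →L[ℝ] X) :
    numericalRadius X S ≤ ‖S‖ := by
  obtain ⟨p, hp, h⟩ := exists_eq_numericalRadius S
  rw [← h]
  refine (norm_apply_le_of_mem_statePairs hp _).trans ?_
  simpa [hp.1] using S.le_opNorm p.1

lemma continuous_numericalRadius (X : Type*) [NormedAddCommGroup X] [NormedSpace ℝ X]
    [FiniteDimensional ℝ X] [Nontrivial X] : Continuous (numericalRadius X) := by
  refine (LipschitzWith.of_le_add fun S T => ?_).continuous
  have h := numericalRadius_add_le T (S - T)
  rw [add_sub_cancel, dist_eq_norm] at *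
  linarith [numericalRadius_le_norm (S - T)]

lemma exists_statePair_mul_ne_zero {X : Type*} [NormedAddCommGroup X] [NormedSpace ℝ X]
    {g : X →L[ℝ] ℝ} {y u : X} (hgy : g y = 1) (hgu : g u = 0) (hu : u ≠ 0) :
    ∃ p ∈ statePairs X, g p.1 * p.2 u ≠ 0 := by
  have hy : y ≠ 0 := by rintro rfl; simp at hgy
  have hy' := norm_pos_iff.2 hy
  have hu' := norm_pos_iff.2 hu
  set t : ℝ := ‖u‖ / (4 * ‖y‖) with ht
  have ht0 : 0 < t := by positivity
  have hty : t * ‖y‖ = ‖u‖ / 4 := by rw [ht]; field_simp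
  have hg : g (u + t • y) = t := by simp [hgy, hgu]
  have hz : u + t • y ≠ 0 := by
    intro h
    rw [h, map_zero] at hg
    exact ht0.ne hg
  obtain ⟨p, hp, hp1, hp2⟩ := exists_mem_statePairs hz
  refine ⟨p, hp, mul_ne_zero ?_ ?_⟩
  · rw [hp1, map_smul, hg]
    exact mul_ne_zero (inv_ne_zero (norm_ne_zero_iff.2 hz)) ht0.ne'
  · have h1 : ‖u‖ ≤ ‖u + t • y‖ + ‖t • y‖ := by simpa using norm_sub_le (u + t • y) (t • y)
    have h2 := norm_apply_le_of_mem_statePairs hp (t • y)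
    have h3 : ‖t • y‖ = ‖u‖ / 4 := by rw [norm_smul, Real.norm_of_nonneg ht0.le, hty]
    rw [map_add] at hp2
    have h4 := le_abs_self (p.2 (t • y))
    rw [Real.norm_eq_abs] at h2
    intro h0
    linarith

lemma exists_pos_mul_norm_le_numericalRadius_smulRight {X : Type*} [NormedAddCommGroup X]
    [NormedSpace ℝ X] [FiniteDimensional ℝ X] [Nontrivial X] {g : X →L[ℝ] ℝ} {y : X}
    (hgy : g y = 1) :
    ∃ c : ℝ, 0 < c ∧ ∀ v : X, g v = 0 → c * ‖v‖ ≤ numericalRadius X (g.smulRight v) := by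
  have : ProperSpace X := FiniteDimensional.proper ℝ X
  have hS : IsCompact (Metric.sphere (0 : X) 1 ∩ {v | g v = 0}) :=
    (isCompact_sphere _ _).inter_right (isClosed_eq (by fun_prop) continuous_const)
  have hcont : Continuous fun v : X => numericalRadius X (g.smulRight v) :=
    (continuous_numericalRadius X).comp (ContinuousLinearMap.smulRightL ℝ X X g).continuous
  have hpos : ∀ v ∈ Metric.sphere (0 : X) 1 ∩ {v | g v = 0},
      0 < numericalRadius X (g.smulRight v) := by
    rintro v ⟨hv1, hv2⟩
    have hv0 : v ≠ 0 := by rintro rfl; simp at hv1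
    obtain ⟨p, hp, hne⟩ := exists_statePair_mul_ne_zero hgy hv2 hv0
    refine lt_of_lt_of_le ?_ (le_numericalRadius _ hp)
    rw [ContinuousLinearMap.smulRight_apply, map_smul]
    exact norm_pos_iff.2 hne
  obtain ⟨c, hc, hcS⟩ := hS.exists_forall_le' hcont.continuousOn hpos
  refine ⟨c, hc, fun v hv => ?_⟩
  rcases eq_or_ne v 0 with rfl | hv0
  · simpa using numericalRadius_nonneg _
  have hn := norm_pos_iff.2 hv0
  have h := hcS (‖v‖⁻¹ • v) ⟨by simp [norm_smul, hn.ne'], by simp [hv]⟩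
  obtain ⟨p, hp, hpe⟩ := exists_eq_numericalRadius (g.smulRight (‖v‖⁻¹ • v))
  have h2 := le_numericalRadius (g.smulRight v) hp
  rw [← hpe] at h
  have h3 : ‖p.2 (g.smulRight (‖v‖⁻¹ • v) p.1)‖ = ‖v‖⁻¹ * ‖p.2 (g.smulRight v p.1)‖ := by
    simp
    ring
  rw [h3] at h
  calc c * ‖v‖ ≤ ‖v‖⁻¹ * ‖p.2 (g.smulRight v p.1)‖ * ‖v‖ := by gcongr
    _ = ‖p.2 (g.smulRight v p.1)‖ := by field_simp
    _ ≤ _ := h2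

lemma exists_numericalRadius_add_smulRight_le {X : Type*} [NormedAddCommGroup X]
    [NormedSpace ℝ X] [FiniteDimensional ℝ X] [Nontrivial X] {g : X →L[ℝ] ℝ} {y : X}
    (hgy : g y = 1) (Q : X →L[ℝ] X) :
    ∃ v, g v = 0 ∧ ∀ w, g w = 0 →
      numericalRadius X (Q + g.smulRight v) ≤ numericalRadius X (Q + g.smulRight w) := by
  have : ProperSpace X := FiniteDimensional.proper ℝ X
  obtain ⟨c, hc, hcV⟩ := exists_pos_mul_norm_le_numericalRadius_smulRight hgy
  have hcont : Continuous fun v : X => numericalRadius X (Q + g.smulRight v) :=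
    (continuous_numericalRadius X).comp
      (continuous_const.add (ContinuousLinearMap.smulRightL ℝ X X g).continuous)
  set R := (numericalRadius X (-Q) + numericalRadius X Q) / c with hR
  have hR0 : 0 ≤ R := div_nonneg (add_nonneg (numericalRadius_nonneg _)
    (numericalRadius_nonneg _)) hc.le
  have hS : IsCompact (Metric.closedBall (0 : X) R ∩ {v | g v = 0}) :=
    (isCompact_closedBall _ _).inter_right (isClosed_eq (by fun_prop) continuous_const)
  have h0S : (0 : X) ∈ Metric.closedBall (0 : X) R ∩ {v | g v = 0} := by simp [hR0]
  obtain ⟨v, hv, hmin⟩ := hS.exists_isMinOn ⟨0, h0S⟩ hcont.continuousOn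
  refine ⟨v, hv.2, fun w hw => ?_⟩
  by_cases hwR : ‖w‖ ≤ R
  · exact hmin (show w ∈ _ from ⟨by simpa using hwR, hw⟩)
  · refine (hmin h0S).trans ?_
    have h1 := hcV w hw
    have h2 := numericalRadius_add_le (-Q) (Q + g.smulRight w)
    rw [neg_add_cancel_left] at h2
    push Not at hwR
    rw [hR, div_lt_iff₀ hc] at hwR
    have h3 : g.smulRight (0 : X) = 0 := by ext; simp
    simp only [h3, add_zero]
    linarith

/-- If `a ≤ 0` on a compact set and `b < 0` wherever `a = 0`, then `n a + b < 0` for some `n`. -/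
lemma IsCompact.exists_nat_mul_add_neg {α : Type*} [TopologicalSpace α]
    [FirstCountableTopology α] {E : Set α} (hE : IsCompact E) {a b : α → ℝ}
    (ha : Continuous a) (hb : Continuous b) (ha0 : ∀ e ∈ E, a e ≤ 0)
    (hab : ∀ e ∈ E, a e = 0 → b e < 0) : ∃ n : ℕ, ∀ e ∈ E, n * a e + b e < 0 := by
  by_contra! h
  choose x hxE hx using h
  obtain ⟨e, he, φ, hφ, hlim⟩ := hE.tendsto_subseq hxE
  have hla : Tendsto (fun n => a (x (φ n))) atTop (𝓝 (a e)) := (ha.tendsto e).comp hlim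
  have hlb : Tendsto (fun n => b (x (φ n))) atTop (𝓝 (b e)) := (hb.tendsto e).comp hlim
  have hb0 : 0 ≤ b e := by
    refine ge_of_tendsto' hlb fun n => ?_
    have h1 := hx (φ n)
    have h2 := mul_nonpos_of_nonneg_of_nonpos (Nat.cast_nonneg (α := ℝ) (φ n))
      (ha0 _ (hxE (φ n)))
    linarith
  have hinv : Tendsto (fun n => ((φ n : ℕ) : ℝ)⁻¹) atTop (𝓝 0) :=
    tendsto_inv_atTop_zero.comp (tendsto_natCast_atTop_atTop.comp hφ.tendsto_atTop)
  have hlim2 : Tendsto (fun n => a (x (φ n)) + ((φ n : ℕ) : ℝ)⁻¹ * b (x (φ n))) atTop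
      (𝓝 (a e + 0 * b e)) := hla.add (hinv.mul hlb)
  have h3 : 0 ≤ a e + 0 * b e := by
    refine ge_of_tendsto hlim2 ?_
    filter_upwards [eventually_ge_atTop 1] with n hn
    have hpos : (0 : ℝ) < φ n := by
      exact_mod_cast lt_of_lt_of_le hn (hφ.id_le n)
    have h4 : a (x (φ n)) + ((φ n : ℕ) : ℝ)⁻¹ * b (x (φ n))
        = ((φ n : ℕ) : ℝ)⁻¹ * (φ n * a (x (φ n)) + b (x (φ n))) := by
      field_simp
    rw [h4]
    exact mul_nonneg (inv_nonneg.2 hpos.le) (hx _)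
  have h5 := hab e he (le_antisymm (ha0 e he) (by linarith))
  linarith

/-- If moving along `T` never lowers the numerical radius of `P`, then some extremal pair of `P`
does not decrease to first order along `T`. -/
lemma exists_extremal_statePair_nonneg {X : Type*} [NormedAddCommGroup X] [NormedSpace ℝ X]
    [FiniteDimensional ℝ X] [Nontrivial X] (P T : X →L[ℝ] X)
    (hmin : ∀ t : ℝ, numericalRadius X P ≤ numericalRadius X (P + t • T)) :
    ∃ p ∈ statePairs X, ‖p.2 (P p.1)‖ = numericalRadius X P ∧
      0 ≤ p.2 (P p.1) * p.2 (T p.1) := by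
  have h : ∀ n : ℕ, ∃ p ∈ statePairs X,
      numericalRadius X P ≤ ‖p.2 ((P + (1 / ((n : ℝ) + 1)) • T) p.1)‖ := fun n => by
    obtain ⟨p, hp, hpe⟩ := exists_eq_numericalRadius (P + (1 / ((n : ℝ) + 1)) • T)
    exact ⟨p, hp, hpe ▸ hmin _⟩
  choose x hxK hx using h
  obtain ⟨p, hp, φ, hφ, hlim⟩ := (isCompact_statePairs X).tendsto_subseq hxK
  have hA : Tendsto (fun n => (x (φ n)).2 (P (x (φ n)).1)) atTop (𝓝 (p.2 (P p.1))) :=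
    ((continuous_apply_statePair P).tendsto p).comp hlim
  have hB : Tendsto (fun n => (x (φ n)).2 (T (x (φ n)).1)) atTop (𝓝 (p.2 (T p.1))) :=
    ((continuous_apply_statePair T).tendsto p).comp hlim
  have ht : Tendsto (fun n => 1 / (((φ n : ℕ) : ℝ) + 1)) atTop (𝓝 0) :=
    tendsto_one_div_add_atTop_nhds_zero_nat.comp hφ.tendsto_atTop
  refine ⟨p, hp, le_antisymm (le_numericalRadius P hp) ?_, ?_⟩
  · have hl := (hA.add (ht.mul hB)).norm
    rw [zero_mul, add_zero] at hl
    refine ge_of_tendsto' hl fun n => ?_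
    simpa using hx (φ n)
  · have hl := ((hA.mul hB).const_mul 2).add (ht.mul (hB.pow 2))
    rw [zero_mul, add_zero] at hl
    have : 0 ≤ 2 * (p.2 (P p.1) * p.2 (T p.1)) := by
      refine ge_of_tendsto' hl fun n => ?_
      have h1 := hx (φ n)
      have h2 := le_numericalRadius P (hxK (φ n))
      have h3 := h2.trans h1
      have htpos : 0 < 1 / (((φ n : ℕ) : ℝ) + 1) := Nat.one_div_pos_of_nat
      set t := 1 / (((φ n : ℕ) : ℝ) + 1)
      rw [Real.norm_eq_abs, Real.norm_eq_abs, ← sq_le_sq] at h3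
      simp only [add_apply, smul_apply, map_add, map_smul, smul_eq_mul] at h3
      refine nonneg_of_mul_nonneg_right ?_ htpos
      nlinarith
    linarith

/-- The sign obstruction behind strong uniqueness: extremal data with a common one-dimensional
restriction cannot pull in opposite directions when the extremal value exceeds one. -/
lemma extremal_signs_incompatible {l p₁ p₂ q₁ q₂ b₁ b₂ g₁ g₂ : ℝ} (hl : 1 < l)
    (h₁ : |b₁ * p₁| = l) (h₂ : |b₂ * p₂| = l)
    (e₁ : b₁ * p₁ + g₁ * q₁ = 1) (e₂ : b₂ * p₂ + g₂ * q₂ = 1)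
    (s₁ : 0 < b₁ * p₁ * (g₁ * p₁)) (s₂ : b₂ * p₂ * (g₂ * p₂) < 0)
    (c₁ : |b₂ * p₁ + g₂ * q₁| ≤ 1) (c₂ : |b₁ * p₂ + g₁ * q₂| ≤ 1) : False := by
  have sq₁ : (b₁ * p₁) ^ 2 = l ^ 2 := by rw [← h₁, sq_abs]
  have sq₂ : (b₂ * p₂) ^ 2 = l ^ 2 := by rw [← h₂, sq_abs]
  have n₁ : b₁ * p₁ * (g₁ * q₁) < 0 := by nlinarith [le_abs_self (b₁ * p₁)]
  have n₂ : b₂ * p₂ * (g₂ * q₂) < 0 := by nlinarith [le_abs_self (b₂ * p₂)]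
  have t₁ : 0 < b₁ * g₁ := by
    by_contra! h
    nlinarith [mul_nonpos_of_nonpos_of_nonneg h (sq_nonneg p₁)]
  have t₂ : b₂ * g₂ < 0 := by
    by_contra! h
    nlinarith [mul_nonneg h (sq_nonneg p₂)]
  have r₁ : p₁ * q₁ < 0 := by
    by_contra! h
    nlinarith [mul_nonneg t₁.le h]
  have r₂ : 0 < p₂ * q₂ := by
    by_contra! h
    nlinarith [mul_nonneg_of_nonpos_of_nonpos t₂.le h]
  have m₁ : 0 < b₂ * p₁ * (g₂ * q₁) := by nlinarith [mul_pos_of_neg_of_neg t₂ r₁]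
  have m₂ : 0 < b₁ * p₂ * (g₁ * q₂) := by nlinarith [mul_pos t₁ r₂]
  rw [← sq_le_one_iff_abs_le_one] at c₁ c₂
  have d₁ : (b₂ * p₁) ^ 2 ≤ 1 := by nlinarith [sq_nonneg (g₂ * q₁)]
  have d₂ : (b₁ * p₂) ^ 2 ≤ 1 := by nlinarith [sq_nonneg (g₁ * q₂)]
  have hprod : (b₂ * p₁) ^ 2 * (b₁ * p₂) ^ 2 ≤ 1 := mul_le_one₀ d₁ (sq_nonneg _) d₂
  have hprod' : (b₂ * p₁) ^ 2 * (b₁ * p₂) ^ 2 = l ^ 2 * l ^ 2 := by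
    nth_rewrite 1 [← sq₁]
    rw [← sq₂]
    ring
  have hl2 : 1 < l ^ 2 := by nlinarith
  nlinarith

lemma exists_forall_mem_eq_smul_add_smul {X : Type*} [AddCommGroup X] [Module ℝ X]
    {V : Submodule ℝ X} (hV : Module.finrank ℝ V = 2) {v : X} (hv : v ∈ V) (hv0 : v ≠ 0) :
    ∃ w ∈ V, ∀ z ∈ V, ∃ a b : ℝ, z = a • v + b • w := by
  have : FiniteDimensional ℝ V := Module.finite_of_finrank_pos (by omega)
  have hcard : Module.finrank ℝ V ≠ 1 := by omega
  obtain ⟨w, hw⟩ : ∃ w : V, w ∉ Submodule.span ℝ {(⟨v, hv⟩ : V)} := by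
    by_contra! h
    refine hcard (finrank_eq_one (⟨v, hv⟩ : V) (by simpa [Subtype.ext_iff] using hv0) fun w => ?_)
    exact Submodule.mem_span_singleton.1 (h w)
  have hli : LinearIndependent ℝ ![(⟨v, hv⟩ : V), w] := by
    rw [LinearIndependent.pair_iff' (by simpa [Subtype.ext_iff] using hv0)]
    intro a ha
    exact hw (Submodule.mem_span_singleton.2 ⟨a, ha⟩)
  have htop := hli.span_eq_top_of_card_eq_finrank' (by simp [hV])
  refine ⟨w, w.2, fun z hz => ?_⟩
  have hz' : (⟨z, hz⟩ : V) ∈ Submodule.span ℝ (Set.range ![(⟨v, hv⟩ : V), w]) := by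
    rw [htop]; trivial
  rw [Matrix.range_cons, Matrix.range_cons, Matrix.range_empty, Set.union_empty,
    Set.singleton_union, Submodule.mem_span_pair] at hz'
  obtain ⟨a, b, hab⟩ := hz'
  exact ⟨a, b, by simpa using (congrArg Subtype.val hab).symm⟩

/-- At a projection of minimal numerical radius `> 1`, every nonzero direction in the
two-dimensional range increases some extremal pair. -/
lemma exists_extremal_statePair_pos {X : Type*} [NormedAddCommGroup X] [NormedSpace ℝ X]
    [FiniteDimensional ℝ X] [Nontrivial X] {V : Submodule ℝ X} (hV : Module.finrank ℝ V = 2)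
    {g : X →L[ℝ] ℝ} {y : X} {P : X →L[ℝ] X} (hPV : ∀ x, P x ∈ V)
    (hPy : ∀ x, x = P x + g x • y)
    (hl : 1 < numericalRadius X P)
    (hmin : ∀ v ∈ V, numericalRadius X P ≤ numericalRadius X (P + g.smulRight v))
    {v : X} (hv : v ∈ V) (hv0 : v ≠ 0) :
    ∃ p ∈ statePairs X, ‖p.2 (P p.1)‖ = numericalRadius X P ∧
      0 < p.2 (P p.1) * (g p.1 * p.2 v) := by
  by_contra! hcon
  obtain ⟨w, hw, hspan⟩ := exists_forall_mem_eq_smul_add_smul hV hv hv0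
  set l := numericalRadius X P
  have hval : ∀ p ∈ statePairs X, p.2 (P p.1) + g p.1 * p.2 y = 1 := fun p hp => by
    have h := congrArg p.2 (hPy p.1)
    rw [hp.2.2, map_add, map_smul, smul_eq_mul] at h
    exact h.symm
  have hA0 : ∀ p : X × (X →L[ℝ] ℝ), ‖p.2 (P p.1)‖ = l → p.2 (P p.1) ≠ 0 := by
    intro p hpl h
    rw [h, norm_zero] at hpl
    linarith
  have hg0 : ∀ p ∈ statePairs X, ‖p.2 (P p.1)‖ = l → g p.1 ≠ 0 := by
    intro p hp hpl h
    have h1 := hval p hp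
    rw [h, zero_mul, add_zero] at h1
    rw [h1, norm_one] at hpl
    linarith
  -- extremal pairs with `f v = 0` all pull `w` in the same direction
  have hpair : ∀ p ∈ statePairs X, ∀ q ∈ statePairs X, ‖p.2 (P p.1)‖ = l →
      ‖q.2 (P q.1)‖ = l → p.2 v = 0 → q.2 v = 0 →
      0 < p.2 (P p.1) * (g p.1 * p.2 w) → q.2 (P q.1) * (g q.1 * q.2 w) < 0 → False := by
    intro p hp q hq hpl hql hpv hqv hs₁ hs₂
    obtain ⟨a₁, b₁, hb₁⟩ := hspan _ (hPV p.1)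
    obtain ⟨a₂, b₂, hb₂⟩ := hspan _ (hPV q.1)
    have hpp : p.2 (P p.1) = b₁ * p.2 w := by simp [hb₁, hpv]
    have hpq : p.2 (P q.1) = b₂ * p.2 w := by simp [hb₂, hpv]
    have hqp : q.2 (P p.1) = b₁ * q.2 w := by simp [hb₁, hqv]
    have hqq : q.2 (P q.1) = b₂ * q.2 w := by simp [hb₂, hqv]
    have hp1 := hval p hp
    have hq1 := hval q hq
    have hcross : ∀ r ∈ statePairs X, ∀ s ∈ statePairs X,
        |r.2 (P s.1) + g s.1 * r.2 y| ≤ 1 := fun r hr s hs => by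
      have h := norm_apply_le_of_mem_statePairs hr s.1
      rw [hs.1, hPy s.1, map_add, map_smul, smul_eq_mul] at h
      exact h
    have hc₁ := hcross p hp q hq
    have hc₂ := hcross q hq p hp
    rw [hpp] at hpl hs₁ hp1
    rw [hqq] at hql hs₂ hq1
    rw [hpq] at hc₁
    rw [hqp] at hc₂
    exact extremal_signs_incompatible hl hpl hql hp1 hq1 hs₁ hs₂ hc₁ hc₂
  have hne : ∀ p ∈ statePairs X, ‖p.2 (P p.1)‖ = l → p.2 v = 0 →
      p.2 (P p.1) * (g p.1 * p.2 w) ≠ 0 := by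
    intro p hp hpl hpv
    refine mul_ne_zero (hA0 p hpl) (mul_ne_zero (hg0 p hp hpl) fun h => hA0 p hpl ?_)
    obtain ⟨a, b, hab⟩ := hspan _ (hPV p.1)
    simp [hab, hpv, h]
  obtain ⟨w', hw', hneg⟩ : ∃ w' ∈ V, ∀ p ∈ statePairs X, ‖p.2 (P p.1)‖ = l → p.2 v = 0 →
      p.2 (P p.1) * (g p.1 * p.2 w') < 0 := by
    by_cases hex : ∃ p ∈ statePairs X, ‖p.2 (P p.1)‖ = l ∧ p.2 v = 0 ∧
        0 < p.2 (P p.1) * (g p.1 * p.2 w)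
    · obtain ⟨p, hp, hpl, hpv, hs⟩ := hex
      refine ⟨-w, V.neg_mem hw, fun q hq hql hqv => ?_⟩
      rcases lt_or_gt_of_ne (hne q hq hql hqv) with h | h
      · exact (hpair p hp q hq hpl hql hpv hqv hs h).elim
      · simpa using h
    · push Not at hex
      exact ⟨w, hw, fun p hp hpl hpv => lt_of_le_of_ne (hex p hp hpl hpv) (hne p hp hpl hpv)⟩
  have hE : IsCompact (statePairs X ∩ {p | ‖p.2 (P p.1)‖ = l}) :=
    (isCompact_statePairs X).inter_right
      (isClosed_eq (continuous_apply_statePair P).norm continuous_const)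
  obtain ⟨n, hn⟩ := hE.exists_nat_mul_add_neg
    (a := fun p => p.2 (P p.1) * (g p.1 * p.2 v)) (b := fun p => p.2 (P p.1) * (g p.1 * p.2 w'))
    (by fun_prop) (by fun_prop) (fun p hp => hcon p hp.1 hp.2) (fun p hp h => by
      refine hneg p hp.1 hp.2 ?_
      rcases mul_eq_zero.1 h with h | h
      · exact absurd h (hA0 p hp.2)
      · exact (mul_eq_zero.1 h).resolve_left (hg0 p hp.1 hp.2))
  obtain ⟨p, hp, hpl, hnn⟩ := exists_extremal_statePair_nonneg P
    (g.smulRight ((n : ℝ) • v + w')) (fun t => by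
      have h := hmin (t • ((n : ℝ) • v + w'))
        (V.smul_mem _ (V.add_mem (V.smul_mem _ hv) hw'))
      convert h using 3
      ext x
      simp [smul_comm t (g x)])
  have h := hn p ⟨hp, hpl⟩
  simp only [ContinuousLinearMap.smulRight_apply, map_smul, map_add, smul_eq_mul] at hnn
  nlinarith

/-- If every nonzero direction in `V` increases some extremal pair, then the numerical radius
grows at least linearly away from `P`. -/
lemma exists_pos_add_mul_norm_le_numericalRadius {X : Type*} [NormedAddCommGroup X]
    [NormedSpace ℝ X] [FiniteDimensional ℝ X] [Nontrivial X] {V : Submodule ℝ X}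
    {g : X →L[ℝ] ℝ} {P : X →L[ℝ] X} (hl : 0 < numericalRadius X P)
    (hpos : ∀ v ∈ V, v ≠ 0 → ∃ p ∈ statePairs X, ‖p.2 (P p.1)‖ = numericalRadius X P ∧
      0 < p.2 (P p.1) * (g p.1 * p.2 v)) :
    ∃ r : ℝ, 0 < r ∧ ∀ v ∈ V,
      numericalRadius X P + r * ‖v‖ ≤ numericalRadius X (P + g.smulRight v) := by
  have : ProperSpace X := FiniteDimensional.proper ℝ X
  by_contra! hcon
  choose v hvV hv using fun n : ℕ =>
    hcon (1 / ((n : ℝ) + 1)) Nat.one_div_pos_of_nat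
  have hv0 : ∀ n, v n ≠ 0 := by
    intro n h
    have h1 := hv n
    have h2 : P + g.smulRight (0 : X) = P := by ext; simp
    rw [h, h2, norm_zero, mul_zero, add_zero] at h1
    exact lt_irrefl _ h1
  have hS : IsCompact (Metric.sphere (0 : X) 1 ∩ V) :=
    (isCompact_sphere _ _).inter_right V.closed_of_finiteDimensional
  obtain ⟨u, hu, φ, hφ, hlim⟩ := hS.tendsto_subseq (x := fun n => ‖v n‖⁻¹ • v n) (fun n =>
    ⟨by simp [norm_smul, hv0 n], V.smul_mem _ (hvV n)⟩)
  have hu0 : u ≠ 0 := by rintro rfl; simpa using hu.1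
  obtain ⟨p, hp, hpl, hpu⟩ := hpos u hu.2 hu0
  set l := numericalRadius X P
  have hcont : Continuous fun z : X => p.2 (P p.1) * (g p.1 * p.2 z) := by fun_prop
  have hlim1 := (hcont.tendsto u).comp hlim
  have ht : Tendsto (fun n => 1 / (((φ n : ℕ) : ℝ) + 1)) atTop (𝓝 0) :=
    tendsto_one_div_add_atTop_nhds_zero_nat.comp hφ.tendsto_atTop
  have hlim2 := ht.const_mul l
  rw [mul_zero] at hlim2
  refine hpu.not_ge (le_of_tendsto_of_tendsto' hlim1 hlim2 fun n => ?_)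
  have hvn := norm_pos_iff.2 (hv0 (φ n))
  have h1 := (le_numericalRadius (P + g.smulRight (v (φ n))) hp).trans (hv (φ n)).le
  set t := 1 / (((φ n : ℕ) : ℝ) + 1)
  simp only [add_apply, ContinuousLinearMap.smulRight_apply, map_add, map_smul,
    smul_eq_mul] at h1
  simp only [Function.comp, map_smul, smul_eq_mul]
  set A := p.2 (P p.1)
  set B := g p.1 * p.2 (v (φ n))
  have h2 : A * (A + B) ≤ l * (l + t * ‖v (φ n)‖) := by
    calc A * (A + B) ≤ |A * (A + B)| := le_abs_self _
      _ = ‖A‖ * ‖A + B‖ := abs_mul _ _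
      _ ≤ _ := by rw [hpl]; gcongr
  have h3 : A * A = l * l := by rw [← hpl, Real.norm_eq_abs, abs_mul_abs_self]
  have h4 : A * B ≤ l * t * ‖v (φ n)‖ := by nlinarith
  have h5 : A * (g p.1 * (‖v (φ n)‖⁻¹ * p.2 (v (φ n)))) = A * B / ‖v (φ n)‖ := by
    simp only [B]; field_simp
  rw [h5, div_le_iff₀ hvn]
  exact h4

lemma exists_functional_ker_eq_of_finrank {X : Type*} [NormedAddCommGroup X] [NormedSpace ℝ X]
    [FiniteDimensional ℝ X] {V : Submodule ℝ X}
    (h : Module.finrank ℝ V + 1 = Module.finrank ℝ X) :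
    ∃ (g : X →L[ℝ] ℝ) (y : X), g y = 1 ∧ ∀ x, x ∈ V ↔ g x = 0 := by
  have hlt : V < ⊤ := lt_top_iff_ne_top.2 (by rintro rfl; simp at h)
  obtain ⟨f, hf0, hf⟩ := V.exists_le_ker_of_lt_top hlt
  have hker : V = LinearMap.ker f := by
    refine Submodule.eq_of_le_of_finrank_eq hf ?_
    have := Module.Dual.finrank_ker_add_one_of_ne_zero (f := f) hf0
    omega
  obtain ⟨z, hz⟩ : ∃ z, f z ≠ 0 := by
    by_contra! h0
    exact hf0 (LinearMap.ext h0)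
  refine ⟨LinearMap.toContinuousLinearMap f, (f z)⁻¹ • z, by simp [hz], fun x => ?_⟩
  rw [hker]
  simp

/-- Aksoy–Lewicki: let `X` be a three-dimensional real Banach space and `V` a
two-dimensional subspace with `λ_w^{id_V} = inf {‖P‖_w : P ∈ 𝒫(X,V)} > 1`. Then there
is exactly one projection `P₀ ∈ 𝒫(X,V)` of minimal numerical radius, and it is a
strongly unique minimal projection with respect to the numerical radius. -/
theorem strongly_unique_minimal_projection_numericalRadius
    {X : Type*} [NormedAddCommGroup X] [NormedSpace ℝ X]
    (hX : Module.finrank ℝ X = 3)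
    (V : Submodule ℝ X) (hV : Module.finrank ℝ V = 2)
    (l : ℝ)
    (hl : l = sInf {r : ℝ | ∃ P : X →L[ℝ] X, (∀ x : X, P x ∈ V) ∧
      (∀ v ∈ V, P v = v) ∧ r = numericalRadius X P})
    (hl1 : 1 < l) :
    (∃! P₀ : X →L[ℝ] X, (∀ x : X, P₀ x ∈ V) ∧ (∀ v ∈ V, P₀ v = v) ∧
      numericalRadius X P₀ = l) ∧
    (∀ P₀ : X →L[ℝ] X, (∀ x : X, P₀ x ∈ V) → (∀ v ∈ V, P₀ v = v) →
      numericalRadius X P₀ = l →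
      ∃ r : ℝ, 0 < r ∧ ∀ P : X →L[ℝ] X, (∀ x : X, P x ∈ V) → (∀ v ∈ V, P v = v) →
        numericalRadius X P₀ + r * numericalRadius X (P - P₀) ≤ numericalRadius X P) := by
  have : FiniteDimensional ℝ X := Module.finite_of_finrank_pos (by omega)
  have : Nontrivial X := Module.nontrivial_of_finrank_pos (R := ℝ) (by omega)
  obtain ⟨g, y, hgy, hVg⟩ := exists_functional_ker_eq_of_finrank (V := V) (by omega)
  have hproj : ∀ P : X →L[ℝ] X, (∀ x, P x ∈ V) → (∀ v ∈ V, P v = v) →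
      ∀ x, x = P x + g x • (y - P y) := by
    intro P _ hP x
    have h := hP (x - g x • y) ((hVg _).2 (by simp [hgy]))
    rw [map_sub, map_smul, sub_eq_sub_iff_add_eq_add] at h
    rw [smul_sub, ← add_sub_assoc, h]
    abel
  have hdiff : ∀ P Q : X →L[ℝ] X, (∀ x, P x ∈ V) → (∀ v ∈ V, P v = v) →
      (∀ x, Q x ∈ V) → (∀ v ∈ V, Q v = v) → P = Q + g.smulRight (P y - Q y) := by
    intro P Q hP hP' hQ hQ'
    ext x
    have h1 := hproj P hP hP' x
    have h2 := hproj Q hQ hQ' x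
    simp only [add_apply, ContinuousLinearMap.smulRight_apply]
    have h3 : P x = x - g x • (y - P y) := eq_sub_of_add_eq h1.symm
    have h4 : Q x = x - g x • (y - Q y) := eq_sub_of_add_eq h2.symm
    rw [h3, h4]
    simp only [smul_sub]
    abel
  have hadd : ∀ Q : X →L[ℝ] X, (∀ x, Q x ∈ V) → (∀ v ∈ V, Q v = v) → ∀ u ∈ V,
      (∀ x, (Q + g.smulRight u) x ∈ V) ∧ ∀ v ∈ V, (Q + g.smulRight u) v = v := by
    intro Q hQ hQ' u hu
    refine ⟨fun x => V.add_mem (hQ x) (V.smul_mem _ hu), fun v hv => ?_⟩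
    simp [hQ' v hv, (hVg v).1 hv]
  have hlow : ∀ P : X →L[ℝ] X, (∀ x, P x ∈ V) → (∀ v ∈ V, P v = v) →
      l ≤ numericalRadius X P := by
    intro P hP hP'
    rw [hl]
    refine csInf_le ⟨0, ?_⟩ ⟨P, hP, hP', rfl⟩
    rintro _ ⟨Q, -, -, rfl⟩
    exact numericalRadius_nonneg Q
  have hstrong : ∀ P₀ : X →L[ℝ] X, (∀ x, P₀ x ∈ V) → (∀ v ∈ V, P₀ v = v) →
      numericalRadius X P₀ = l → ∃ r : ℝ, 0 < r ∧ ∀ v ∈ V,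
        numericalRadius X P₀ + r * ‖v‖ ≤ numericalRadius X (P₀ + g.smulRight v) := by
    intro P₀ hP hP' hPl
    refine exists_pos_add_mul_norm_le_numericalRadius (by linarith) fun v hv hv0 => ?_
    refine exists_extremal_statePair_pos hV hP (hproj P₀ hP hP') (by linarith)
      (fun u hu => ?_) hv hv0
    rw [hPl]
    exact hlow _ (hadd P₀ hP hP' u hu).1 (hadd P₀ hP hP' u hu).2
  constructor
  · set Q : X →L[ℝ] X := ContinuousLinearMap.id ℝ X - g.smulRight y with hQdef
    have hQ : ∀ x, Q x ∈ V := fun x => (hVg _).2 (by simp [hQdef, hgy])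
    have hQ' : ∀ v ∈ V, Q v = v := fun v hv => by simp [hQdef, (hVg v).1 hv]
    obtain ⟨v, hv, hmin⟩ := exists_numericalRadius_add_smulRight_le hgy Q
    obtain ⟨hP, hP'⟩ := hadd Q hQ hQ' v ((hVg v).2 hv)
    have hPl : numericalRadius X (Q + g.smulRight v) = l := by
      refine le_antisymm ?_ (hlow _ hP hP')
      rw [hl]
      refine le_csInf ⟨_, Q, hQ, hQ', rfl⟩ ?_
      rintro _ ⟨R, hR, hR', rfl⟩
      rw [hdiff R Q hR hR' hQ hQ']
      exact hmin _ ((hVg _).1 (V.sub_mem (hR y) (hQ y)))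
    refine ⟨Q + g.smulRight v, ⟨hP, hP', hPl⟩, ?_⟩
    rintro R ⟨hR, hR', hRl⟩
    obtain ⟨r, hr, hrV⟩ := hstrong _ hP hP' hPl
    have h := hdiff R _ hR hR' hP hP'
    have h1 := hrV (R y - (Q + g.smulRight v) y) (V.sub_mem (hR y) (hP y))
    rw [← h, hPl, hRl] at h1
    have h2 : ‖R y - (Q + g.smulRight v) y‖ = 0 :=
      le_antisymm (nonpos_of_mul_nonpos_right (by linarith) hr) (norm_nonneg _)
    rw [h, norm_eq_zero.1 h2]
    ext x
    simp
  · intro P₀ hP hP' hPl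
    obtain ⟨r, hr, hrV⟩ := hstrong P₀ hP hP' hPl
    have hg : 0 < ‖g‖ := norm_pos_iff.2 (by rintro rfl; simp at hgy)
    refine ⟨r / ‖g‖, div_pos hr hg, fun R hR hR' => ?_⟩
    have h := hdiff R P₀ hR hR' hP hP'
    have h1 := hrV (R y - P₀ y) (V.sub_mem (hR y) (hP y))
    have h2 : numericalRadius X (R - P₀) ≤ ‖g‖ * ‖R y - P₀ y‖ := by
      rw [sub_eq_of_eq_add' h, ← ContinuousLinearMap.norm_smulRight_apply]
      exact numericalRadius_le_norm _
    rw [← h] at h1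
    refine le_trans ?_ h1
    have h3 : r / ‖g‖ * numericalRadius X (R - P₀) ≤ r / ‖g‖ * (‖g‖ * ‖R y - P₀ y‖) := by
      gcongr
    rw [← mul_assoc, div_mul_cancel₀ _ hg.ne'] at h3
    linarith
end

section
/- Let X = ℝ³ with the sup norm (ℓ_∞^3) and V = {x ∈ X : x_1 + x_2 = 0}. Define P_1 x = x − (x_1 + x_2)(1,0,0) and P_2 x = x − (x_1 + x_2)(0,1,0). Then P_1 and P_2 are both projections of X onto V, P_1 ≠ P_2, and ‖P_1‖ = ‖P_1‖_w = ‖P_2‖ = ‖P_2‖_w = 1. In particular there is no strongly unique minimal projection of X onto V with respect to numerical radius. -/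
/-- `ℓ∞³`: `ℝ³` with the sup norm (the product norm on `Fin 3 → ℝ`). -/
abbrev linf3 : Type := Fin 3 → ℝ

/-- The subspace `V = {x : x₁ + x₂ = 0}` of `ℓ∞³`. -/
noncomputable def Vsub : Submodule ℝ linf3 :=
  LinearMap.ker ((LinearMap.proj 0 : linf3 →ₗ[ℝ] ℝ) + LinearMap.proj 1)

/-- `P₁ x = x - (x₁ + x₂)(1,0,0)`. -/
noncomputable def P₁ : linf3 →L[ℝ] linf3 :=
  LinearMap.toContinuousLinearMap
    (LinearMap.id - ((LinearMap.proj 0 : linf3 →ₗ[ℝ] ℝ) + LinearMap.proj 1).smulRight ![1, 0, 0])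

/-- `P₂ x = x - (x₁ + x₂)(0,1,0)`. -/
noncomputable def P₂ : linf3 →L[ℝ] linf3 :=
  LinearMap.toContinuousLinearMap
    (LinearMap.id - ((LinearMap.proj 0 : linf3 →ₗ[ℝ] ℝ) + LinearMap.proj 1).smulRight ![0, 1, 0])

section NumericalRadius

variable {X : Type*} [NormedAddCommGroup X] [NormedSpace ℝ X]

lemma norm_apply_apply_le_opNorm (S : X →L[ℝ] X) {x : X} {f : X →L[ℝ] ℝ}
    (hx : ‖x‖ = 1) (hf : ‖f‖ = 1) : ‖f (S x)‖ ≤ ‖S‖ := by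
  calc ‖f (S x)‖ ≤ ‖f‖ * ‖S x‖ := f.le_opNorm _
    _ ≤ ‖S‖ := by simpa [hx, hf] using S.le_opNorm x

lemma numericalRadius_le_opNorm (S : X →L[ℝ] X) : numericalRadius X S ≤ ‖S‖ := by
  refine Real.sSup_le ?_ (norm_nonneg S)
  rintro r ⟨x, f, hx, hf, -, rfl⟩
  exact norm_apply_apply_le_opNorm S hx hf

lemma le_numericalRadius_s17 (S : X →L[ℝ] X) {x : X} {f : X →L[ℝ] ℝ}
    (hx : ‖x‖ = 1) (hf : ‖f‖ = 1) (hfx : f x = 1) : ‖f (S x)‖ ≤ numericalRadius X S := by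
  refine le_csSup ⟨‖S‖, ?_⟩ ⟨x, f, hx, hf, hfx, rfl⟩
  rintro r ⟨y, g, hy, hg, -, rfl⟩
  exact norm_apply_apply_le_opNorm S hy hg

end NumericalRadius

lemma norm_coord_le_numericalRadius (S : linf3 →L[ℝ] linf3) {x : linf3} {i : Fin 3}
    (hx : ‖x‖ = 1) (hxi : x i = 1) : ‖S x i‖ ≤ numericalRadius linf3 S := by
  have hf : ‖(ContinuousLinearMap.proj i : linf3 →L[ℝ] ℝ)‖ = 1 := by
    refine le_antisymm
      (ContinuousLinearMap.opNorm_le_bound _ zero_le_one fun y ↦ ?_) ?_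
    · simpa using norm_le_pi_norm y i
    · simpa [hx, hxi] using (ContinuousLinearMap.proj i : linf3 →L[ℝ] ℝ).le_opNorm x
  simpa using le_numericalRadius_s17 S hx hf hxi

lemma mem_Vsub {x : linf3} : x ∈ Vsub ↔ x 0 + x 1 = 0 := by
  simp [Vsub]

lemma P₁_apply (x : linf3) : P₁ x = ![-x 1, x 1, x 2] := by
  ext i
  fin_cases i <;> simp [P₁]

lemma P₂_apply (x : linf3) : P₂ x = ![x 0, -x 0, x 2] := by
  ext i
  fin_cases i <;> simp [P₂]

lemma P₁_mem (x : linf3) : P₁ x ∈ Vsub := by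
  simp [mem_Vsub, P₁_apply]

lemma P₂_mem (x : linf3) : P₂ x ∈ Vsub := by
  simp [mem_Vsub, P₂_apply]

lemma P₁_eq_self {v : linf3} (hv : v ∈ Vsub) : P₁ v = v := by
  rw [mem_Vsub] at hv
  ext i
  fin_cases i <;> simp [P₁_apply]
  linarith

lemma P₂_eq_self {v : linf3} (hv : v ∈ Vsub) : P₂ v = v := by
  rw [mem_Vsub] at hv
  ext i
  fin_cases i <;> simp [P₂_apply]
  linarith

lemma norm_P₁_le : ‖P₁‖ ≤ 1 := by
  refine ContinuousLinearMap.opNorm_le_bound _ zero_le_one fun x ↦ ?_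
  rw [one_mul, pi_norm_le_iff_of_nonneg (norm_nonneg x)]
  intro i
  fin_cases i
  · simpa [P₁_apply] using norm_le_pi_norm x 1
  · simpa [P₁_apply] using norm_le_pi_norm x 1
  · simpa [P₁_apply] using norm_le_pi_norm x 2

lemma norm_P₂_le : ‖P₂‖ ≤ 1 := by
  refine ContinuousLinearMap.opNorm_le_bound _ zero_le_one fun x ↦ ?_
  rw [one_mul, pi_norm_le_iff_of_nonneg (norm_nonneg x)]
  intro i
  fin_cases i
  · simpa [P₂_apply] using norm_le_pi_norm x 0
  · simpa [P₂_apply] using norm_le_pi_norm x 0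
  · simpa [P₂_apply] using norm_le_pi_norm x 2

lemma one_le_numericalRadius_of_eqOn_Vsub {P : linf3 →L[ℝ] linf3} (hP : ∀ v ∈ Vsub, P v = v) :
    1 ≤ numericalRadius linf3 P := by
  have h := norm_coord_le_numericalRadius P (x := Pi.single 2 1) (i := 2)
    ((Pi.norm_single _).trans norm_one) (by simp)
  rw [hP _ (by simp [mem_Vsub])] at h
  simpa using h

lemma norm_one_one_zero : ‖(![1, 1, 0] : linf3)‖ = 1 := by
  refine le_antisymm ((pi_norm_le_iff_of_nonneg zero_le_one).2 fun i ↦ ?_) ?_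
  · fin_cases i <;> simp
  · simpa using norm_le_pi_norm (![1, 1, 0] : linf3) 0

/-- In `ℓ∞³` with `V = {x : x₁ + x₂ = 0}`, the maps `P₁ x = x - (x₁+x₂)(1,0,0)` and
`P₂ x = x - (x₁+x₂)(0,1,0)` are two distinct projections onto `V` with
`‖P₁‖ = ‖P₁‖_w = ‖P₂‖ = ‖P₂‖_w = 1`; in particular there is no strongly unique minimal
projection of `ℓ∞³` onto `V` with respect to the numerical radius. -/
theorem no_strongly_unique_minimal_projection_linf3 :
    (∀ x, P₁ x ∈ Vsub) ∧ (∀ v ∈ Vsub, P₁ v = v) ∧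
    (∀ x, P₂ x ∈ Vsub) ∧ (∀ v ∈ Vsub, P₂ v = v) ∧
    P₁ ≠ P₂ ∧
    ‖P₁‖ = 1 ∧ numericalRadius linf3 P₁ = 1 ∧ ‖P₂‖ = 1 ∧ numericalRadius linf3 P₂ = 1 ∧
    ¬ ∃ P₀ : linf3 →L[ℝ] linf3, (∀ x, P₀ x ∈ Vsub) ∧ (∀ v ∈ Vsub, P₀ v = v) ∧
        ∃ r : ℝ, 0 < r ∧ ∀ P : linf3 →L[ℝ] linf3, (∀ x, P x ∈ Vsub) → (∀ v ∈ Vsub, P v = v) →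
          numericalRadius linf3 P₀ + r * numericalRadius linf3 (P - P₀) ≤
            numericalRadius linf3 P := by
  have one_le {P : linf3 →L[ℝ] linf3} (hP : ∀ v ∈ Vsub, P v = v) :=
    one_le_numericalRadius_of_eqOn_Vsub hP
  have h₁ : ‖P₁‖ = 1 :=
    le_antisymm norm_P₁_le ((one_le fun _ ↦ P₁_eq_self).trans (numericalRadius_le_opNorm P₁))
  have h₂ : ‖P₂‖ = 1 :=
    le_antisymm norm_P₂_le ((one_le fun _ ↦ P₂_eq_self).trans (numericalRadius_le_opNorm P₂))
  have hw₁ : numericalRadius linf3 P₁ = 1 :=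
    le_antisymm ((numericalRadius_le_opNorm P₁).trans h₁.le) (one_le fun _ ↦ P₁_eq_self)
  have hw₂ : numericalRadius linf3 P₂ = 1 :=
    le_antisymm ((numericalRadius_le_opNorm P₂).trans h₂.le) (one_le fun _ ↦ P₂_eq_self)
  refine ⟨P₁_mem, fun _ ↦ P₁_eq_self, P₂_mem, fun _ ↦ P₂_eq_self, fun h ↦ ?_,
    h₁, hw₁, h₂, hw₂, ?_⟩
  · have := congrFun (DFunLike.congr_fun h ![1, 1, 0]) 0
    norm_num [P₁_apply, P₂_apply] at this
  · rintro ⟨P₀, -, hP₀, r, hr, H⟩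
    have coord_eq (P : linf3 →L[ℝ] linf3) (hmem : ∀ x, P x ∈ Vsub) (hP : ∀ v ∈ Vsub, P v = v)
        (hw : numericalRadius linf3 P = 1) : P ![1, 1, 0] 0 = P₀ ![1, 1, 0] 0 := by
      have hle : numericalRadius linf3 (P - P₀) ≤ 0 := by
        have := H P hmem hP
        have := one_le hP₀
        by_contra! hpos
        nlinarith [mul_pos hr hpos]
      have h := (norm_coord_le_numericalRadius (P - P₀) (i := 0) norm_one_one_zero
        (by simp)).trans hle
      exact sub_eq_zero.1 (norm_le_zero_iff.1 h)
    have e := (coord_eq P₁ P₁_mem (fun _ ↦ P₁_eq_self) hw₁).trans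
      (coord_eq P₂ P₂_mem (fun _ ↦ P₂_eq_self) hw₂).symm
    norm_num [P₁_apply, P₂_apply] at e
end
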